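/- There is a constant D > 0 such that for all sufficiently large m and all integers n with 4 ≤ n, s(m,n,2) ≥ D · m^{1 − 1/⌊n/4⌋}. -/

import Mathlib

/-- A Boolean decision tree over an `s`-bit memory: each internal node probes a
bit at an index in `[s]`, each leaf is marked Yes (`true`) or No (`false`). -/
inductive DTree (s : ℕ) : Type
  | leaf (b : Bool) : DTree s
  | node (i : Fin s) (f0 f1 : DTree s) : DTree s

/-- Depth of a decision tree. -/
def DTree.depth {s : ℕ} : DTree s → ℕ
  | .leaf _ => 0
  | .node _ f0 f1 => max f0.depth f1.depth + 1

/-- Evaluating a decision tree on a memory `σ : Fin s → Bool`: at a node probing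
index `i`, follow the edge labeled by the bit `σ i`. -/
def DTree.eval {s : ℕ} : DTree s → (Fin s → Bool) → Bool
  | .leaf b, _ => b
  | .node i f0 f1, σ => if σ i then f1.eval σ else f0.eval σ

/-- An `(m,n,s,t)`-scheme: a storing scheme `φ` mapping subsets of `[m]` of size at
most `n` to `s`-bit strings, together with a family of decision trees of depth at
most `t` answering membership queries correctly. -/
def SchemeExists (m n s t : ℕ) : Prop :=
  ∃ (φ : Finset (Fin m) → (Fin s → Bool)) (T : Fin m → DTree s),
    (∀ u : Fin m, (T u).depth ≤ t) ∧
    ∀ S : Finset (Fin m), S.card ≤ n → ∀ u : Fin m, ((T u).eval (φ S) = true ↔ u ∈ S)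

/-- `sFun m n t` is the minimum `s` such that an `(m,n,s,t)`-scheme exists. -/
noncomputable def sFun (m n t : ℕ) : ℕ := sInf {s : ℕ | SchemeExists m n s t}

open Finset

section Forcing

variable {α β γ : Type*} [DecidableEq α] [DecidableEq β] [DecidableEq γ]

/-- The answer of a two-probe query: the first probe reads `x (a u)`, whose value selects the cell
of the second probe. -/
def twoProbeAnswer (a : α → β) (cell : Bool → α → γ) (x : β → Bool) (y : Bool → γ → Bool)
    (u : α) : Bool :=
  y (x (a u)) (cell (x (a u)) u)

/-- The memory `(x, y)` answers Yes on `S` and No on `N`. -/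
def Realizes (a : α → β) (cell : Bool → α → γ) (x : β → Bool) (y : Bool → γ → Bool)
    (S N : Finset α) : Prop :=
  (∀ u ∈ S, twoProbeAnswer a cell x y u = true) ∧ ∀ u ∈ N, twoProbeAnswer a cell x y u = false

/-- Some set `S ⊆ E` with at most `c` elements, together with a set `N ⊆ E` of non-members,
rules out the value `e₀` for the first-probe cell `g₀`. -/
def Refutable (a : α → β) (cell : Bool → α → γ) (E : Finset α) (g₀ : β) (e₀ : Bool) (c : ℕ) :
    Prop :=
  ∃ S N : Finset α, S ⊆ E ∧ N ⊆ E ∧ Disjoint S N ∧ #S ≤ c ∧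
    ∀ x y, Realizes a cell x y S N → x g₀ ≠ e₀

/-- All fibres of `a` and of both cell maps in `E` have at least `δ` elements. -/
def MinDegree (a : α → β) (cell : Bool → α → γ) (E : Finset α) (δ : ℕ) : Prop :=
  ∀ u ∈ E, δ ≤ #{v ∈ E | a v = a u} ∧ ∀ e, δ ≤ #{v ∈ E | cell e v = cell e u}

/-- The value `e₀` at `g₀` propagates, in `j` rounds, to the cells in `V`: with the elements of `N`
outside the stored set, storing the at most `j` elements of `A g` forces the value `val g` at
`g ∈ V`. The elements of `P` are those that have been used for propagation. -/
structure Propagation (a : α → β) (cell : Bool → α → γ) (E : Finset α) (g₀ : β) (e₀ : Bool)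
    (j : ℕ) (V : Finset β) (val : β → Bool) (N P : Finset α) (A : β → Finset α) : Prop where
  subset_image : V ⊆ E.image a
  N_subset : N ⊆ E
  P_subset : P ⊆ E
  disjoint : Disjoint P N
  N_mem : ∀ u ∈ N, a u ∈ V
  N_inj : Set.InjOn a N
  P_mem : ∀ u ∈ P, a u ∈ V
  P_inj : ∀ u ∈ P, ∀ v ∈ P, val (a u) = val (a v) → cell (val (a u)) u = cell (val (a u)) v → u = v
  A_subset : ∀ g ∈ V, A g ⊆ P
  A_card : ∀ g ∈ V, #(A g) ≤ j
  forces : ∀ g ∈ V, ∀ x y, x g₀ = e₀ → Realizes a cell x y (A g) N → x g = val g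

variable {a : α → β} {cell : Bool → α → γ} {E : Finset α} {g₀ : β} {e₀ : Bool}

omit [DecidableEq α] [DecidableEq β] [DecidableEq γ] in
lemma Realizes.mono {x : β → Bool} {y : Bool → γ → Bool} {S N S' N' : Finset α}
    (h : Realizes a cell x y S N) (hS : S' ⊆ S) (hN : N' ⊆ N) : Realizes a cell x y S' N' :=
  ⟨fun u hu => h.1 u (hS hu), fun u hu => h.2 u (hN hu)⟩

omit [DecidableEq α] [DecidableEq γ] in
lemma propagation_zero (hg : g₀ ∈ E.image a) :
    Propagation a cell E g₀ e₀ 0 {g₀} (fun _ => e₀) ∅ ∅ (fun _ => ∅) where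
  subset_image := by simpa using hg
  N_subset := by simp
  P_subset := by simp
  disjoint := by simp
  N_mem := by simp
  N_inj := by simp
  P_mem := by simp
  P_inj := by simp
  A_subset := by simp
  A_card := by simp
  forces := by
    intro g hg x y hx _
    rw [mem_singleton.1 hg, hx]

/-- The elements available for propagating from the cells in `V`. -/
def exits (a : α → β) (E : Finset α) (V : Finset β) (N : Finset α) : Finset α :=
  {u ∈ E | a u ∈ V ∧ u ∉ N}

/-- The elements sharing with some element of `X` the second-probe cell that is read there. -/
def entries (a : α → β) (cell : Bool → α → γ) (E : Finset α) (val : β → Bool) (X : Finset α) :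
    Finset α :=
  {v ∈ E | ∃ u ∈ X, v ≠ u ∧ cell (val (a u)) v = cell (val (a u)) u}

namespace Propagation

variable {j : ℕ} {V : Finset β} {val : β → Bool} {N P : Finset α} {A : β → Finset α}

omit [DecidableEq γ] in
lemma P_subset_exits (h : Propagation a cell E g₀ e₀ j V val N P A) : P ⊆ exits a E V N :=
  fun u hu => mem_filter.2 ⟨h.P_subset hu, h.P_mem u hu, disjoint_left.1 h.disjoint hu⟩

omit [DecidableEq γ] in
lemma refutable_of_collision_of_notMem (h : Propagation a cell E g₀ e₀ j V val N P A) {u v : α}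
    (hu : u ∈ exits a E V N) (hv : v ∈ exits a E V N) (huv : u ≠ v)
    (hval : val (a u) = val (a v)) (hcell : cell (val (a u)) u = cell (val (a u)) v)
    (hvP : v ∉ P) : Refutable a cell E g₀ e₀ (2 * (j + 1)) := by
  simp only [exits, mem_filter] at hu hv
  have hAu := h.A_subset _ hu.2.1
  have hAv := h.A_subset _ hv.2.1
  refine ⟨insert u (A (a u) ∪ A (a v)), insert v N, ?_, ?_, ?_, ?_, ?_⟩
  · exact insert_subset hu.1 (union_subset (hAu.trans h.P_subset) (hAv.trans h.P_subset))
  · exact insert_subset hv.1 h.N_subset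
  · have := disjoint_left.1 h.disjoint
    rw [disjoint_left]
    intro w hw hw'
    simp only [mem_insert, mem_union] at hw hw'
    grind
  · have h1 := card_insert_le u (A (a u) ∪ A (a v))
    have h2 := card_union_le (A (a u)) (A (a v))
    have h3 := h.A_card _ hu.2.1
    have h4 := h.A_card _ hv.2.1
    omega
  · intro x y hR hx
    have h1 := h.forces _ hu.2.1 x y hx (hR.mono (by grind) (by grind))
    have h2 := h.forces _ hv.2.1 x y hx (hR.mono (by grind) (by grind))
    have h3 := hR.1 u (by simp)
    have h4 := hR.2 v (by simp)
    simp only [twoProbeAnswer, h1, h2] at h3 h4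
    rw [← hval, ← hcell, h3] at h4
    simp at h4

omit [DecidableEq γ] in
lemma refutable_of_collision (h : Propagation a cell E g₀ e₀ j V val N P A) {u v : α}
    (hu : u ∈ exits a E V N) (hv : v ∈ exits a E V N) (huv : u ≠ v)
    (hval : val (a u) = val (a v)) (hcell : cell (val (a u)) u = cell (val (a u)) v) :
    Refutable a cell E g₀ e₀ (2 * (j + 1)) := by
  by_cases hvP : v ∈ P
  · by_cases huP : u ∈ P
    · exact absurd (h.P_inj u huP v hvP hval hcell) huv
    · exact h.refutable_of_collision_of_notMem hv hu huv.symm hval.symm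
        (by rw [← hval, hcell]) huP
  · exact h.refutable_of_collision_of_notMem hu hv huv hval hcell hvP

lemma exists_succ [Nonempty α] (h : Propagation a cell E g₀ e₀ j V val N P A)
    (hinj : ∀ u ∈ exits a E V N, ∀ v ∈ exits a E V N, val (a u) = val (a v) →
      cell (val (a u)) u = cell (val (a u)) v → u = v) :
    ∃ val' N' P' A', Propagation a cell E g₀ e₀ (j + 1)
      (V ∪ (entries a cell E val (exits a E V N)).image a) val' N' P' A' := by
  set X := exits a E V N with hX
  set Y := entries a cell E val X with hY
  have hex : ∀ g ∈ Y.image a, ∃ v u, v ∈ E ∧ u ∈ X ∧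
      cell (val (a u)) v = cell (val (a u)) u ∧ a v = g := by
    intro g hg
    obtain ⟨v, hv, rfl⟩ := mem_image.1 hg
    obtain ⟨hvE, u, hu, -, hc⟩ := mem_filter.1 hv
    exact ⟨v, u, hvE, hu, hc, rfl⟩
  choose! v u hvE hu hc hav using hex
  have hXE : ∀ w ∈ X, w ∈ E ∧ a w ∈ V ∧ w ∉ N := fun w hw => mem_filter.1 hw
  have hPX : P ⊆ X := h.P_subset_exits
  set N' := N ∪ (Y.image a \ V).image v with hN'
  refine ⟨fun g => if g ∈ V then val g else !val (a (u g)), N', X,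
    fun g => if g ∈ V then A g else insert (u g) (A (a (u g))), ?_⟩
  constructor
  · exact union_subset h.subset_image (image_subset_image (filter_subset _ _))
  · refine union_subset h.N_subset (image_subset_iff.2 fun g hg => ?_)
    exact hvE g (mem_sdiff.1 hg).1
  · exact fun w hw => (hXE w hw).1
  · rw [disjoint_left]
    intro w hw hw'
    rcases mem_union.1 hw' with hw' | hw'
    · exact (hXE w hw).2.2 hw'
    · obtain ⟨g, hg, rfl⟩ := mem_image.1 hw'
      rw [mem_sdiff] at hg
      exact hg.2 (hav g hg.1 ▸ (hXE _ hw).2.1)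
  · intro w hw
    rcases mem_union.1 hw with hw | hw
    · exact mem_union_left _ (h.N_mem w hw)
    · obtain ⟨g, hg, rfl⟩ := mem_image.1 hw
      rw [mem_sdiff] at hg
      rw [hav g hg.1]
      exact mem_union_right _ hg.1
  · intro w hw w' hw' heq
    simp only [hN', coe_union, Set.mem_union, mem_coe, mem_image, mem_sdiff] at hw hw'
    rcases hw with hw | ⟨g, hg, rfl⟩ <;> rcases hw' with hw' | ⟨g', hg', rfl⟩
    · exact h.N_inj hw hw' heq
    · exact absurd (h.N_mem w hw) (by rw [heq, hav g' (by simpa using hg'.1)]; exact hg'.2)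
    · exact absurd (h.N_mem w' hw') (by rw [← heq, hav g (by simpa using hg.1)]; exact hg.2)
    · rw [hav g (by simpa using hg.1), hav g' (by simpa using hg'.1)] at heq
      rw [heq]
  · exact fun w hw => mem_union_left _ (hXE w hw).2.1
  · intro w hw w' hw'
    simp only [(hXE w hw).2.1, (hXE w' hw').2.1, if_true]
    exact hinj w hw w' hw'
  · intro g hg
    by_cases hgV : g ∈ V
    · simpa [hgV] using (h.A_subset g hgV).trans hPX
    · have hgY : g ∈ Y.image a := (mem_union.1 hg).resolve_left hgV
      simpa [hgV] using insert_subset (hu g hgY)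
        ((h.A_subset _ (hXE _ (hu g hgY)).2.1).trans hPX)
  · intro g hg
    by_cases hgV : g ∈ V
    · simpa [hgV] using (h.A_card g hgV).trans (Nat.le_succ j)
    · have hgY : g ∈ Y.image a := (mem_union.1 hg).resolve_left hgV
      simpa [hgV] using (card_insert_le _ _).trans
        (Nat.succ_le_succ (h.A_card _ (hXE _ (hu g hgY)).2.1))
  · intro g hg x y hx hR
    by_cases hgV : g ∈ V
    · simp only [hgV, if_true] at hR ⊢
      exact h.forces g hgV x y hx (hR.mono subset_rfl subset_union_left)
    · have hgY : g ∈ Y.image a := (mem_union.1 hg).resolve_left hgV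
      simp only [hgV, if_false] at hR ⊢
      have h1 := h.forces _ (hXE _ (hu g hgY)).2.1 x y hx
        (hR.mono (subset_insert _ _) subset_union_left)
      have h2 := hR.1 (u g) (mem_insert_self _ _)
      have h3 := hR.2 (v g) (mem_union_right _ (mem_image_of_mem v (mem_sdiff.2 ⟨hgY, hgV⟩)))
      simp only [twoProbeAnswer] at h2 h3
      rw [Bool.eq_not]
      intro h4
      rw [hav g hgY, h4, hc g hgY, ← h1, h2] at h3
      simp at h3

lemma card_exits (h : Propagation a cell E g₀ e₀ j V val N P A) {δ : ℕ} (hδ : 2 ≤ δ)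
    (hdeg : MinDegree a cell E δ) :
    #{u ∈ E | a u ∈ V} ≤ 2 * #(exits a E V N) := by
  have hN : #N ≤ #V := card_le_card_of_injOn a h.N_mem h.N_inj
  have hsplit : #{u ∈ E | a u ∈ V} ≤ #(exits a E V N) + #N := by
    refine (card_le_card fun u hu => ?_).trans (card_union_le _ _)
    by_cases huN : u ∈ N <;> simp_all [exits]
  have hV : #V * δ ≤ #{u ∈ E | a u ∈ V} := by
    rw [card_eq_sum_card_fiberwise (s := {u ∈ E | a u ∈ V}) (f := a) (t := V)
      fun u hu => (mem_filter.1 hu).2, ← smul_eq_mul]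
    refine card_nsmul_le_sum _ _ _ fun g hg => ?_
    obtain ⟨u, hu, rfl⟩ := mem_image.1 (h.subset_image hg)
    refine (hdeg u hu).1.trans (card_le_card fun w hw => ?_)
    simp only [mem_filter] at hw ⊢
    exact ⟨⟨hw.1, hw.2 ▸ hg⟩, hw.2⟩
  nlinarith

end Propagation

lemma card_entries {val : β → Bool} {X : Finset α} {δ : ℕ} (hdeg : MinDegree a cell E δ)
    (hXE : X ⊆ E)
    (hinj : ∀ u ∈ X, ∀ v ∈ X, val (a u) = val (a v) →
      cell (val (a u)) u = cell (val (a u)) v → u = v) :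
    #X * (δ - 1) ≤ #(entries a cell E val X) * 2 := by
  refine card_mul_le_card_mul
    (fun u v => v ≠ u ∧ cell (val (a u)) v = cell (val (a u)) u) (fun u hu => ?_) fun v _ => ?_
  · have hle := (hdeg u (hXE hu)).2 (val (a u))
    have := pred_card_le_card_erase (s := {v ∈ E | cell (val (a u)) v = cell (val (a u)) u})
      (a := u)
    refine (Nat.sub_le_sub_right hle 1).trans (this.trans (card_le_card fun v hv => ?_))
    simp only [mem_erase, mem_filter] at hv
    simp only [bipartiteAbove, entries, mem_filter]
    exact ⟨⟨hv.2.1, u, hu, hv.1, hv.2.2⟩, hv.1, hv.2.2⟩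
  · rw [← Fintype.card_bool, ← card_univ]
    refine card_le_card_of_injOn (fun u => val (a u)) (fun _ _ => mem_univ _) ?_
    intro u hu u' hu' heq
    simp only [bipartiteBelow, coe_filter, Set.mem_ofPred_eq] at hu hu' heq
    refine hinj u hu.1 u' hu'.1 heq ?_
    rw [← hu.2.2, heq, hu'.2.2]

/-- Either `e₀` is refuted within `j` rounds, or propagation continues for `j` rounds and the cells
reached carry at least `(δ / 8) ^ j` elements. -/
lemma refutable_or_exists_propagation {δ : ℕ} (hδ : 2 ≤ δ) (hdeg : MinDegree a cell E δ)
    (hg : g₀ ∈ E.image a) (j : ℕ) :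
    Refutable a cell E g₀ e₀ (2 * j) ∨
      ∃ V val N P A, Propagation a cell E g₀ e₀ j V val N P A ∧
        δ ^ j ≤ 8 ^ j * #{u ∈ E | a u ∈ V} := by
  obtain ⟨u₀, hu₀, hau₀⟩ := mem_image.1 hg
  have : Nonempty α := ⟨u₀⟩
  induction j with
  | zero =>
    refine Or.inr ⟨_, _, _, _, _, propagation_zero hg, ?_⟩
    rw [pow_zero, pow_zero, one_mul, Nat.one_le_iff_ne_zero, ← Nat.pos_iff_ne_zero, card_pos]
    exact ⟨u₀, by simp [hu₀, hau₀]⟩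
  | succ j ih =>
    rcases ih with ⟨S, N, hS, hN, hd, hc, hR⟩ | ⟨V, val, N, P, A, h, hw⟩
    · exact Or.inl ⟨S, N, hS, hN, hd, by omega, hR⟩
    by_cases hinj : ∀ u ∈ exits a E V N, ∀ v ∈ exits a E V N, val (a u) = val (a v) →
      cell (val (a u)) u = cell (val (a u)) v → u = v
    · obtain ⟨val', N', P', A', h'⟩ := h.exists_succ hinj
      refine Or.inr ⟨_, val', N', P', A', h', ?_⟩
      have h1 := h.card_exits hδ hdeg
      set X := exits a E V N
      have h2 : #X * (δ - 1) ≤ _ := card_entries hdeg (filter_subset _ _) hinj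
      change _ ≤ #(entries a cell E val X) * 2 at h2
      have h3 : #(entries a cell E val X) ≤
          #{u ∈ E | a u ∈ V ∪ (entries a cell E val X).image a} :=
        card_le_card fun v hv => mem_filter.2
          ⟨(mem_filter.1 hv).1, mem_union_right _ (mem_image_of_mem a hv)⟩
      set w := #{u ∈ E | a u ∈ V}
      set w' := #{u ∈ E | a u ∈ V ∪ (entries a cell E val X).image a}
      have h4 : δ * w ≤ 8 * w' := by
        obtain ⟨d, rfl⟩ := Nat.exists_eq_add_of_le hδ
        have : 2 + d - 1 = d + 1 := by omega
        rw [this] at h2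
        nlinarith
      calc δ ^ (j + 1) = δ ^ j * δ := pow_succ _ _
        _ ≤ 8 ^ j * w * δ := Nat.mul_le_mul_right _ hw
        _ = 8 ^ j * (δ * w) := by ring
        _ ≤ 8 ^ j * (8 * w') := Nat.mul_le_mul_left _ h4
        _ = 8 ^ (j + 1) * w' := by ring
    · push Not at hinj
      obtain ⟨u, hu, v, hv, hval, hcell, hne⟩ := hinj
      exact Or.inl (h.refutable_of_collision hu hv hne hval hcell)

lemma refutable_of_minDegree {δ k : ℕ} (hδ : 2 ≤ δ) (hdeg : MinDegree a cell E δ)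
    (hg : g₀ ∈ E.image a) (hk : 8 ^ k * #E < δ ^ k) : Refutable a cell E g₀ e₀ (2 * k) := by
  rcases refutable_or_exists_propagation (e₀ := e₀) hδ hdeg hg k with
    h | ⟨V, val, N, P, A, -, hw⟩
  · exact h
  · have : #{u ∈ E | a u ∈ V} ≤ #E := card_le_card (filter_subset _ _)
    exact absurd (hw.trans (Nat.mul_le_mul_left _ this)) hk.not_ge

omit [DecidableEq α] in
lemma card_image_filter_ne_lt {κ : Type*} [DecidableEq κ] (f : α → κ) {F : Finset α} {u : α}
    (hu : u ∈ F) : #(({v ∈ F | ¬ f v = f u}).image f) < #(F.image f) := by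
  refine card_lt_card ⟨image_subset_image (filter_subset _ _), fun hsub => ?_⟩
  obtain ⟨v, hv, hvu⟩ := mem_image.1 (hsub (mem_image_of_mem f hu))
  exact (mem_filter.1 hv).2 hvu

lemma exists_minDegree_subset [Fintype β] [Fintype γ] (a : α → β) (cell : Bool → α → γ)
    (E : Finset α) (δ : ℕ) :
    ∃ F ⊆ E, MinDegree a cell F δ ∧
      #(E \ F) ≤ δ * (Fintype.card β + 2 * Fintype.card γ) := by
  set live : Finset α → ℕ := fun F =>
    #(F.image a) + (#(F.image (cell false)) + #(F.image (cell true))) with hlive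
  obtain ⟨F, hF, hmin⟩ := exists_min_image E.powerset (fun F => #(E \ F) + δ * live F)
    ⟨E, mem_powerset_self E⟩
  rw [mem_powerset] at hF
  have key : ∀ (p : α → Prop) [DecidablePred p], live {v ∈ F | ¬ p v} < live F →
      δ ≤ #{v ∈ F | p v} := by
    intro p _ hlt
    have h1 := hmin {v ∈ F | ¬ p v} (mem_powerset.2 ((filter_subset _ _).trans hF))
    have h2 := card_sdiff_add_card_eq_card hF
    have h3 := card_sdiff_add_card_eq_card ((filter_subset (fun v => ¬ p v) F).trans hF)
    have h4 := card_filter_add_card_filter_not (s := F) p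
    nlinarith
  have hmono : ∀ {κ : Type _} [DecidableEq κ] (f : α → κ) (p : α → Prop) [DecidablePred p],
      #(({v ∈ F | p v}).image f) ≤ #(F.image f) := fun f p _ =>
    card_le_card (image_subset_image (filter_subset _ _))
  refine ⟨F, hF, fun u hu => ⟨key _ ?_, fun e => key _ ?_⟩, ?_⟩
  · have h1 := card_image_filter_ne_lt a hu
    have h2 := hmono (cell false) (fun v => ¬ a v = a u)
    have h3 := hmono (cell true) (fun v => ¬ a v = a u)
    simp only [hlive]
    omega
  · have h1 := card_image_filter_ne_lt (cell e) hu
    have h2 := card_le_card (image_subset_image (f := a)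
      (filter_subset (fun v => ¬ cell e v = cell e u) F))
    have h3 := hmono (cell !e) (fun v => ¬ cell e v = cell e u)
    cases e <;> simp only [hlive, Bool.not_false, Bool.not_true] at * <;> omega
  · have h1 := hmin E (mem_powerset_self E)
    have h2 : live E ≤ Fintype.card β + 2 * Fintype.card γ := by
      have := card_le_univ (E.image a)
      have := card_le_univ (E.image (cell false))
      have := card_le_univ (E.image (cell true))
      simp only [hlive]
      omega
    simp only [sdiff_self, bot_eq_empty, card_empty, zero_add] at h1
    have := Nat.mul_le_mul_left δ h2
    omega

/-- With `δ` small compared to the average degree, there are disjoint sets of minimum degree `δ`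
having a first-probe cell in common. -/
lemma exists_disjoint_minDegree [Fintype α] [Fintype β] [Fintype γ] (a : α → β)
    (cell : Bool → α → γ) (δ : ℕ)
    (hδ : 4 * (δ * (Fintype.card β + 2 * Fintype.card γ)) + Fintype.card β < Fintype.card α) :
    ∃ F₀ F₁ : Finset α, Disjoint F₀ F₁ ∧ MinDegree a cell F₀ δ ∧ MinDegree a cell F₁ δ ∧
      ∃ g, g ∈ F₀.image a ∧ g ∈ F₁.image a := by
  have hhalf : ∀ g : β, ∃ T ⊆ ({u | a u = g} : Finset α), #T = #{u | a u = g} / 2 :=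
    fun g => exists_subset_card_eq (Nat.div_le_self _ _)
  choose T hT hTcard using hhalf
  have haT : ∀ {g u}, u ∈ T g → a u = g := fun h => (mem_filter.1 (hT _ h)).2
  set E₀ : Finset α := {u | u ∈ T (a u)} with hE₀
  obtain ⟨F₀, hF₀, hd₀, hc₀⟩ := exists_minDegree_subset a cell E₀ δ
  obtain ⟨F₁, hF₁, hd₁, hc₁⟩ := exists_minDegree_subset a cell E₀ᶜ δ
  refine ⟨F₀, F₁, disjoint_of_subset_left hF₀ (disjoint_of_subset_right hF₁ disjoint_compl_right),
    hd₀, hd₁, ?_⟩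
  by_contra! hcon
  set L := (E₀ \ F₀) ∪ (E₀ᶜ \ F₁) with hL
  have hfib : ∀ g : β, #{u | a u = g} ≤ 2 * #{u ∈ L | a u = g} + 1 := by
    intro g
    have hT' := card_sdiff_add_card_eq_card (hT g)
    by_cases hg : g ∈ F₀.image a
    · have : ({u | a u = g} : Finset α) \ T g ⊆ {u ∈ L | a u = g} := by
        intro u hu
        simp only [mem_sdiff, mem_filter, mem_univ, true_and] at hu
        obtain ⟨rfl, hu⟩ := hu
        have : u ∉ F₁ := fun h => hcon _ hg (mem_image_of_mem a h)
        simp [hL, hE₀, hu, this]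
      have := card_le_card this
      have := hTcard g
      omega
    · have : T g ⊆ {u ∈ L | a u = g} := by
        intro u hu
        obtain rfl := haT hu
        have : u ∉ F₀ := fun h => hg (mem_image_of_mem a h)
        simp [hL, hE₀, hu, this]
      have := card_le_card this
      have := hTcard g
      omega
  have h1 : Fintype.card α ≤ 2 * #L + Fintype.card β := by
    calc Fintype.card α = ∑ g : β, #{u | a u = g} := by
          rw [← card_univ]
          exact card_eq_sum_card_fiberwise fun _ _ => mem_univ _
      _ ≤ ∑ g : β, (2 * #{u ∈ L | a u = g} + 1) := sum_le_sum fun g _ => hfib g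
      _ = 2 * #L + Fintype.card β := by
          rw [sum_add_distrib, ← mul_sum,
            ← card_eq_sum_card_fiberwise (f := a) (t := univ) fun _ _ => mem_univ _]
          simp
  have h2 : #L ≤ #(E₀ \ F₀) + #(E₀ᶜ \ F₁) := card_union_le _ _
  omega

/-- In a dense two-probe system, storing some set of at most `4 * k` elements is impossible. -/
lemma exists_not_storable [Fintype α] [Fintype β] [Fintype γ] (a : α → β)
    (cell : Bool → α → γ) {δ k : ℕ} (hδ : 2 ≤ δ) (hk : 8 ^ k * Fintype.card α < δ ^ k)
    (hcard : 4 * (δ * (Fintype.card β + 2 * Fintype.card γ)) + Fintype.card β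
      < Fintype.card α) :
    ∃ S : Finset α, #S ≤ 4 * k ∧ ∀ x y, ∃ u, ¬ (twoProbeAnswer a cell x y u = true ↔ u ∈ S) := by
  obtain ⟨F₀, F₁, hdisj, hd₀, hd₁, g, hg₀, hg₁⟩ := exists_disjoint_minDegree a cell δ hcard
  have hk' : ∀ F : Finset α, 8 ^ k * #F < δ ^ k := fun F =>
    (Nat.mul_le_mul_left _ (card_le_univ F)).trans_lt hk
  obtain ⟨S₀, N₀, hS₀, hN₀, hSN₀, hc₀, hR₀⟩ :=
    refutable_of_minDegree (e₀ := false) hδ hd₀ hg₀ (hk' F₀)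
  obtain ⟨S₁, N₁, hS₁, hN₁, hSN₁, hc₁, hR₁⟩ :=
    refutable_of_minDegree (e₀ := true) hδ hd₁ hg₁ (hk' F₁)
  refine ⟨S₀ ∪ S₁, (card_union_le _ _).trans (by omega), fun x y => ?_⟩
  by_contra! hall
  rw [disjoint_left] at hdisj hSN₀ hSN₁
  have hno : ∀ u, u ∉ S₀ ∪ S₁ → twoProbeAnswer a cell x y u = false := fun u hu =>
    Bool.eq_false_iff.2 fun h => hu ((hall u).1 h)
  have h0 : x g ≠ false := hR₀ x y ⟨fun u hu => (hall u).2 (mem_union_left _ hu), fun u hu =>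
    hno u fun h => (mem_union.1 h).elim (fun h => hSN₀ h hu) fun h => hdisj (hN₀ hu) (hS₁ h)⟩
  have h1 : x g ≠ true := hR₁ x y ⟨fun u hu => (hall u).2 (mem_union_right _ hu), fun u hu =>
    hno u fun h => (mem_union.1 h).elim (fun h => hdisj (hS₀ h) (hN₁ hu)) fun h => hSN₁ h hu⟩
  cases hx : x g
  · exact h0 hx
  · exact h1 hx

end Forcing

section Schemes

lemma DTree.exists_of_depth_le_one {s : ℕ} [NeZero s] (t : DTree s) (ht : t.depth ≤ 1) :
    ∃ p : Fin s × (Bool → Bool), ∀ σ, t.eval σ = p.2 (σ p.1) := by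
  match t, ht with
  | .leaf b, _ => exact ⟨(0, fun _ => b), fun σ => rfl⟩
  | .node i (.leaf b₀) (.leaf b₁), _ =>
    exact ⟨(i, fun c => if c then b₁ else b₀), fun σ => rfl⟩
  | .node i (.node _ _ _) _, h => simp [DTree.depth] at h
  | .node i _ (.node _ _ _), h => simp [DTree.depth] at h

lemma DTree.exists_of_depth_le_two {s : ℕ} [NeZero s] (t : DTree s) (ht : t.depth ≤ 2) :
    ∃ (i : Fin s) (c : Bool → Fin s × (Bool → Bool)),
      ∀ σ, t.eval σ = (c (σ i)).2 (σ (c (σ i)).1) := by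
  cases t with
  | leaf b => exact ⟨0, fun _ => (0, fun _ => b), fun σ => rfl⟩
  | node i f₀ f₁ =>
    simp only [DTree.depth] at ht
    obtain ⟨p₀, h₀⟩ := f₀.exists_of_depth_le_one (by omega)
    obtain ⟨p₁, h₁⟩ := f₁.exists_of_depth_le_one (by omega)
    refine ⟨i, fun b => if b then p₁ else p₀, fun σ => ?_⟩
    cases h : σ i <;> simp [DTree.eval, h, h₀, h₁]

lemma not_schemeExists {m n s δ k : ℕ} [NeZero s] (hδ : 2 ≤ δ) (hk : 8 ^ k * m < δ ^ k)
    (hn : 4 * k ≤ n) (hm : 36 * δ * s + s < m) : ¬ SchemeExists m n s 2 := by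
  rintro ⟨φ, T, hdepth, hT⟩
  choose a c hc using fun u => (T u).exists_of_depth_le_two (hdepth u)
  obtain ⟨S, hS, hbad⟩ := exists_not_storable a (fun b u => c u b) (δ := δ) (k := k) hδ
    (by simpa using hk) (by simp; linarith)
  obtain ⟨u, hu⟩ := hbad (φ S) (fun _ p => p.2 (φ S p.1))
  exact hu (by simpa only [twoProbeAnswer, hc] using hT S (hS.trans hn) u)

lemma schemeExists_self (m n : ℕ) : SchemeExists m n m 2 := by
  refine ⟨fun S u => decide (u ∈ S), fun u => .node u (.leaf false) (.leaf true), fun u => ?_,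
    fun S _ u => ?_⟩
  · simp [DTree.depth]
  · by_cases h : u ∈ S <;> simp [DTree.eval, h]

lemma not_schemeExists_zero {m n t : ℕ} (hm : 0 < m) (hn : 0 < n) : ¬ SchemeExists m n 0 t := by
  rintro ⟨φ, T, -, hT⟩
  have h0 := hT ∅ (by simp) ⟨0, hm⟩
  have h1 := hT {⟨0, hm⟩} (by rw [card_singleton]; exact hn) ⟨0, hm⟩
  rw [Subsingleton.elim (φ {⟨0, hm⟩}) (φ ∅), h0] at h1
  simp at h1

lemma schemeExists_sFun (m n : ℕ) : SchemeExists m n (sFun m n 2) 2 :=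
  Nat.sInf_mem (s := {s | SchemeExists m n s 2}) ⟨m, schemeExists_self m n⟩

end Schemes

/-- There is a constant `D > 0` such that for all sufficiently large `m` and all
integers `n ≥ 4`, `s(m,n,2) ≥ D · m^(1 - 1/⌊n/4⌋)`. -/
theorem two_probe_lower_bound :
    ∃ D : ℝ, 0 < D ∧ ∃ M : ℕ, ∀ m : ℕ, M ≤ m → ∀ n : ℕ, 4 ≤ n →
      D * (m : ℝ) ^ ((1 : ℝ) - 1 / ((n / 4 : ℕ) : ℝ)) ≤ (sFun m n 2 : ℝ) := by
  refine ⟨1 / 1000, by norm_num, 1, fun m hm n hn => ?_⟩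
  have hscheme := schemeExists_sFun m n
  set s := sFun m n 2
  have hs : NeZero s := ⟨fun h => not_schemeExists_zero hm (by omega) (h ▸ hscheme)⟩
  have hkpos : 0 < n / 4 := by omega
  have hkn : 4 * (n / 4) ≤ n := Nat.mul_div_le n 4
  generalize n / 4 = k at hkpos hkn ⊢
  by_contra! hlt
  have hm1 : (1 : ℝ) ≤ m := by exact_mod_cast hm
  have hk1 : (1 : ℝ) ≤ k := by exact_mod_cast hkpos
  set r : ℝ := (m : ℝ) ^ ((1 : ℝ) / k) with hr
  have hr1 : 1 ≤ r := Real.one_le_rpow hm1 (by positivity)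
  have hrk : r ^ k = m := by
    rw [hr, one_div, Real.rpow_inv_natCast_pow (by positivity) hkpos.ne']
  have hpow : (m : ℝ) ^ ((1 : ℝ) - 1 / k) = m / r := by
    rw [Real.rpow_sub (by positivity), Real.rpow_one]
  rw [hpow] at hlt
  have hsr : 1000 * (r * s) < m := by
    have : 1 / 1000 * ((m : ℝ) / r) * r = 1 / 1000 * m := by field_simp
    nlinarith
  have hfl : (⌊9 * r⌋₊ : ℝ) ≤ 9 * r := Nat.floor_le (by positivity)
  have hfl' : 9 * r < ⌊9 * r⌋₊ + 1 := Nat.lt_floor_add_one _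
  set δ := ⌊9 * r⌋₊
  have h8 : 8 * r < δ := by linarith
  refine not_schemeExists (δ := δ) (k := k) ?_ ?_ hkn ?_ hscheme
  · have : (8 : ℝ) < δ := by linarith
    have : 8 < δ := by exact_mod_cast this
    omega
  · have : (8 * r) ^ k < (δ : ℝ) ^ k := pow_lt_pow_left₀ h8 (by positivity) hkpos.ne'
    rw [mul_pow, hrk] at this
    exact_mod_cast this
  · have hs0 : (0 : ℝ) ≤ s := Nat.cast_nonneg s
    have : (36 * δ * s + s : ℝ) < m := by nlinarith
    exact_mod_cast this
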